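/- If R ⊆ C_ε is a minimal Phan residue of type I, then I is spherical and δ^θ(c) = w_I for every chamber c ∈ R, where w_I is the longest element of (W_I, I). -/

import Mathlib

universe u v

/-- A twin building of type `(W,S)` (where `S` is the set of simple reflections of the
Coxeter system `cs`), with positive half `Cp` and negative half `Cm`, distance functions
`δp`, `δm`, codistance `δst : Cp × Cm → W`, `δts : Cm × Cp → W`, together with a
quasi-flip: maps `θp : Cp → Cm`, `θm : Cm → Cp` inverse to each other and an automorphism
`π` of `W` with `π(S) = S`, `π ∘ π = id`, compatible with the distances and the
codistance. -/
structure QuasiFlipTwinBuilding {B : Type*} {W : Type*} [Group W]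
    (M : CoxeterMatrix B) (cs : CoxeterSystem M W)
    (Cp : Type u) (Cm : Type v) where
  δp : Cp → Cp → W
  δm : Cm → Cm → W
  δst : Cp → Cm → W
  δts : Cm → Cp → W
  θp : Cp → Cm
  θm : Cm → Cp
  π : W ≃* W
  nonempty_p : Nonempty Cp
  nonempty_m : Nonempty Cm
  /-- (Bu1) for the positive half -/
  p_eq_one_iff : ∀ x y : Cp, δp x y = 1 ↔ x = y
  /-- (Bu1) for the negative half -/
  m_eq_one_iff : ∀ x y : Cm, δm x y = 1 ↔ x = y
  /-- (Bu2) for the positive half -/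
  p_two : ∀ (x y z : Cp) (s : W), s ∈ Set.range cs.simple → δp y z = s →
    δp x z = δp x y ∨ δp x z = δp x y * s
  p_two' : ∀ (x y z : Cp) (s : W), s ∈ Set.range cs.simple → δp y z = s →
    cs.length (δp x y * s) = cs.length (δp x y) + 1 → δp x z = δp x y * s
  /-- (Bu2) for the negative half -/
  m_two : ∀ (x y z : Cm) (s : W), s ∈ Set.range cs.simple → δm y z = s →
    δm x z = δm x y ∨ δm x z = δm x y * s
  m_two' : ∀ (x y z : Cm) (s : W), s ∈ Set.range cs.simple → δm y z = s →
    cs.length (δm x y * s) = cs.length (δm x y) + 1 → δm x z = δm x y * s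
  /-- (Bu3) for the positive half -/
  p_three : ∀ (x y : Cp) (s : W), s ∈ Set.range cs.simple →
    ∃ z : Cp, δp y z = s ∧ δp x z = δp x y * s
  /-- (Bu3) for the negative half -/
  m_three : ∀ (x y : Cm) (s : W), s ∈ Set.range cs.simple →
    ∃ z : Cm, δm y z = s ∧ δm x z = δm x y * s
  /-- (Tw1) -/
  tw1 : ∀ (x : Cp) (y : Cm), δts y x = (δst x y)⁻¹
  /-- (Tw2), positive-to-negative -/
  tw2p : ∀ (x : Cp) (y z : Cm) (s : W), s ∈ Set.range cs.simple → δm y z = s →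
    cs.length (δst x y * s) + 1 = cs.length (δst x y) → δst x z = δst x y * s
  /-- (Tw2), negative-to-positive -/
  tw2m : ∀ (x : Cm) (y z : Cp) (s : W), s ∈ Set.range cs.simple → δp y z = s →
    cs.length (δts x y * s) + 1 = cs.length (δts x y) → δts x z = δts x y * s
  /-- (Tw3), positive-to-negative -/
  tw3p : ∀ (x : Cp) (y : Cm) (s : W), s ∈ Set.range cs.simple →
    ∃ z : Cm, δm y z = s ∧ δst x z = δst x y * s
  /-- (Tw3), negative-to-positive -/
  tw3m : ∀ (x : Cm) (y : Cp) (s : W), s ∈ Set.range cs.simple →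
    ∃ z : Cp, δp y z = s ∧ δts x z = δts x y * s
  /-- `θ ∘ θ = id` -/
  θmθp : ∀ c : Cp, θm (θp c) = c
  θpθm : ∀ c : Cm, θp (θm c) = c
  /-- `π(S) = S` -/
  πS : ⇑π '' Set.range cs.simple = Set.range cs.simple
  /-- `π ∘ π = id` -/
  ππ : ∀ w : W, π (π w) = w
  /-- `θ` interchanges the distances via `π` -/
  flip_p : ∀ x y : Cp, δm (θp x) (θp y) = π (δp x y)
  flip_m : ∀ x y : Cm, δp (θm x) (θm y) = π (δm x y)
  /-- `θ` preserves the codistance via `π` -/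
  flip_st : ∀ (x : Cp) (z : Cm), δts (θp x) (θm z) = π (δst x z)
  flip_ts : ∀ (x : Cm) (z : Cp), δst (θm x) (θp z) = π (δts x z)

namespace QuasiFlipTwinBuilding

variable {B : Type*} {W : Type*} [Group W] {M : CoxeterMatrix B} {cs : CoxeterSystem M W}
  {Cp : Type u} {Cm : Type v}

/-- The same twin building with a quasi-flip, with the roles of the two halves
interchanged. -/
def swap (T : QuasiFlipTwinBuilding M cs Cp Cm) : QuasiFlipTwinBuilding M cs Cm Cp where
  δp := T.δm
  δm := T.δp
  δst := T.δts
  δts := T.δst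
  θp := T.θm
  θm := T.θp
  π := T.π
  nonempty_p := T.nonempty_m
  nonempty_m := T.nonempty_p
  p_eq_one_iff := T.m_eq_one_iff
  m_eq_one_iff := T.p_eq_one_iff
  p_two := T.m_two
  p_two' := T.m_two'
  m_two := T.p_two
  m_two' := T.p_two'
  p_three := T.m_three
  m_three := T.p_three
  tw1 := fun x y => by rw [T.tw1 y x, inv_inv]
  tw2p := T.tw2m
  tw2m := T.tw2p
  tw3p := T.tw3m
  tw3m := T.tw3p
  θmθp := T.θpθm
  θpθm := T.θmθp
  πS := T.πS
  ππ := T.ππ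
  flip_p := T.flip_m
  flip_m := T.flip_p
  flip_st := T.flip_ts
  flip_ts := T.flip_st

variable (T : QuasiFlipTwinBuilding M cs Cp Cm)

/-- The `θ`-codistance `δ^θ(c) = δ*(c, θ(c))` of a chamber of the positive half. -/
def δθ (c : Cp) : W := T.δst c (T.θp c)

/-- The numerical `θ`-codistance `ℓ^θ(c) = ℓ(δ^θ(c))`. -/
noncomputable def ℓθ (c : Cp) : ℕ := cs.length (T.δθ c)

/-- The `s`-panel of a chamber `c`. -/
def panel (s : W) (c : Cp) : Set Cp := {d | T.δp c d = 1 ∨ T.δp c d = s}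

/-- The `J`-residue of a chamber `c`. -/
def residue (J : Set W) (c : Cp) : Set Cp := {d | T.δp c d ∈ Subgroup.closure J}

/-- Opposition of chambers: `δ*(c,d) = 1`. -/
def Opp (c : Cp) (d : Cm) : Prop := T.δst c d = 1

/-- `R` is a Phan residue of type `J`: `R` is a `J`-residue, every chamber of `R` is
opposite some chamber of `θ(R)`, and every chamber of `θ(R)` is opposite some chamber
of `R`. -/
def IsPhan (J : Set W) (R : Set Cp) : Prop :=
  (∃ c : Cp, R = T.residue J c) ∧
  (∀ r ∈ R, ∃ r' ∈ R, T.Opp r (T.θp r')) ∧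
  (∀ r' ∈ R, ∃ r ∈ R, T.Opp r (T.θp r'))

/-- `R` is a minimal Phan residue of type `J`: it is a Phan residue containing no Phan
residue as a proper subset. -/
def IsMinPhan (J : Set W) (R : Set Cp) : Prop :=
  T.IsPhan J R ∧ ∀ (J' : Set W) (R' : Set Cp), J' ⊆ Set.range cs.simple →
    T.IsPhan J' R' → R' ⊆ R → R' = R

/-- Two chambers are `J`-adjacent: they are `j`-adjacent for some `j ∈ J`. -/
def adjJ (J : Set W) (c d : Cp) : Prop := ∃ j ∈ J, T.δp c d = 1 ∨ T.δp c d = j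

/-- There is a `J`-gallery from `c` to `d` all of whose chambers lie in `X`. -/
def GalleryIn (X : Set Cp) (J : Set W) (c d : Cp) : Prop :=
  ∃ γ : List Cp, γ.head? = some c ∧ γ.getLast? = some d ∧
    γ.Chain' (T.adjJ J) ∧ ∀ x ∈ γ, x ∈ X

/-- The flip-flop system of a set `R` of chambers: the chambers of `R` whose numerical
`θ`-codistance is minimal among chambers of `R`. -/
def flipflop (R : Set Cp) : Set Cp := {c ∈ R | ∀ d ∈ R, T.ℓθ c ≤ T.ℓθ d}

/-- The flip-flop system `R^θ` is connected: any two of its chambers are joined by a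
gallery all of whose chambers lie in `R^θ`. -/
def ConnectedFF (R : Set Cp) : Prop :=
  ∀ c ∈ T.flipflop R, ∀ d ∈ T.flipflop R,
    T.GalleryIn (T.flipflop R) (Set.range cs.simple) c d

/-- `R` admits direct descent into `R^θ`: from every chamber of `R` there is a gallery
within `R` ending in `R^θ` along which the numerical `θ`-codistance strictly decreases. -/
def DirectDescent (R : Set Cp) : Prop :=
  ∀ c ∈ R, ∃ γ : List Cp, γ.head? = some c ∧
    (∃ e, γ.getLast? = some e ∧ e ∈ T.flipflop R) ∧
    γ.Chain' (T.adjJ (Set.range cs.simple)) ∧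
    γ.Chain' (fun a b => T.ℓθ b < T.ℓθ a) ∧
    ∀ x ∈ γ, x ∈ R

/-- The quasi-flip is strong on this half: for every chamber `c` and every `s ∈ S` there
are chambers `d, x` in the `s`-panel of `c` with `ℓ(δ*(x, θ(d))) > ℓ(δ*(d, θ(d)))`,
i.e. the projection of `θ(d)` onto the panel is not `d`. -/
def IsStrongHalf : Prop :=
  ∀ (c : Cp) (s : W), s ∈ Set.range cs.simple →
    ∃ d ∈ T.panel s c, ∃ x ∈ T.panel s c,
      cs.length (T.δst d (T.θp d)) < cs.length (T.δst x (T.θp d))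

end QuasiFlipTwinBuilding

namespace CoxeterSystem

variable {B : Type*} {W : Type*} [Group W] {M : CoxeterMatrix B} (cs : CoxeterSystem M W)

theorem reverse_alternatingWord_two_mul (i j : B) (m : ℕ) :
    (alternatingWord i j (2 * m)).reverse = alternatingWord j i (2 * m) := by
  refine List.ext_getElem (by simp) fun k h₁ h₂ => ?_
  simp only [List.length_reverse, length_alternatingWord] at h₁ h₂
  rw [List.getElem_reverse, getElem_alternatingWord _ _ _ _ (by simp; omega),
    getElem_alternatingWord _ _ _ _ h₂, length_alternatingWord]
  by_cases hk : Even k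
  · have h : ¬ Even (2 * m + (2 * m - 1 - k)) := by
      rw [Nat.even_iff] at hk ⊢; omega
    have h' : Even (2 * m + k) := by rw [Nat.even_iff] at hk ⊢; omega
    rw [if_neg h, if_pos h']
  · have h : Even (2 * m + (2 * m - 1 - k)) := by
      rw [Nat.even_iff] at hk ⊢; omega
    have h' : ¬ Even (2 * m + k) := by rw [Nat.even_iff] at hk ⊢; omega
    rw [if_pos h, if_neg h']

open scoped Classical in
theorem even_count_rightInvSeq_alternatingWord (i j : B) (x : W) :
    Even ((cs.rightInvSeq (alternatingWord i j (2 * M i j))).count x) := by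
  rw [← reverse_alternatingWord_two_mul, rightInvSeq_reverse, List.count_reverse]
  set m := M i j with hm
  set l := cs.leftInvSeq (alternatingWord j i (2 * m)) with hl
  have hlen : l.length = 2 * m := by simp [hl]
  have key : l.drop m = l.take m := by
    refine List.ext_getElem (by simp [hlen]; omega) fun k h₁ h₂ => ?_
    have hk : k < m := by simp at h₂; omega
    rw [List.getElem_drop, List.getElem_take]
    simp only [hl]
    rw [cs.getElem_leftInvSeq_alternatingWord j i m (m + k) (by omega),
      cs.getElem_leftInvSeq_alternatingWord j i m k (by omega),
      prod_alternatingWord_eq_mul_pow, prod_alternatingWord_eq_mul_pow,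
      show (2 * (m + k) + 1) / 2 = m + k by omega, show (2 * k + 1) / 2 = k by omega,
      pow_add, hm, cs.simple_mul_simple_pow, one_mul]
    simp
  rw [← List.take_append_drop m l, List.count_append, key]
  exact ⟨_, rfl⟩

open scoped Classical in
/-- The action of a simple reflection on signed group elements. -/
noncomputable def signedConj (i : B) : Function.End (W × ZMod 2) :=
  fun p => (cs.simple i * p.1 * cs.simple i, p.2 + if p.1 = cs.simple i then 1 else 0)

open scoped Classical in
theorem prod_map_signedConj_apply (ω : List B) (x : W) (e : ZMod 2) :
    (ω.map cs.signedConj).prod (x, e) =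
      (cs.wordProd ω * x * (cs.wordProd ω)⁻¹, e + ((cs.rightInvSeq ω).count x : ZMod 2)) := by
  induction ω with
  | nil => simp [Function.End.one_def]
  | cons i ω ih =>
    have hiff : cs.wordProd ω * x * (cs.wordProd ω)⁻¹ = cs.simple i ↔
        (cs.wordProd ω)⁻¹ * cs.simple i * cs.wordProd ω = x := by
      constructor
      · intro h; rw [← h]; group
      · intro h; rw [← h]; group
    rw [List.map_cons, List.prod_cons]
    change cs.signedConj i ((ω.map cs.signedConj).prod (x, e)) = _
    rw [ih]
    simp only [signedConj, rightInvSeq, wordProd_cons, List.count_cons, hiff, beq_iff_eq,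
      mul_inv_rev, inv_simple]
    refine Prod.ext (by simp only [mul_assoc]) ?_
    push_cast
    simp only [add_assoc]

theorem prod_map_alternatingWord_two_mul {G : Type*} [Monoid G] (f : B → G) (i j : B) (p : ℕ) :
    ((alternatingWord i j (2 * p)).map f).prod = (f i * f j) ^ p := by
  induction p with
  | zero => simp [alternatingWord]
  | succ p ih =>
    rw [show 2 * (p + 1) = 2 * p + 1 + 1 by ring, alternatingWord_succ', alternatingWord_succ',
      if_neg (by simp), if_pos (by simp), List.map_cons, List.map_cons, List.prod_cons,
      List.prod_cons, ih, pow_succ', mul_assoc]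

theorem isLiftable_signedConj : M.IsLiftable cs.signedConj := by
  classical
  intro i j
  rw [← prod_map_alternatingWord_two_mul]
  funext ⟨x, e⟩
  rw [prod_map_signedConj_apply, (ZMod.natCast_eq_zero_iff_even).2
    (cs.even_count_rightInvSeq_alternatingWord i j x), wordProd,
    prod_map_alternatingWord_two_mul, simple_mul_simple_pow]
  simp [Function.End.one_def]

open scoped Classical in
theorem count_rightInvSeq_eq_of_wordProd_eq {ω ω' : List B}
    (h : cs.wordProd ω = cs.wordProd ω') (x : W) :
    ((cs.rightInvSeq ω).count x : ZMod 2) = (cs.rightInvSeq ω').count x := by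
  have hφ : ∀ ω : List B,
      cs.lift ⟨cs.signedConj, cs.isLiftable_signedConj⟩ (cs.wordProd ω) =
        (ω.map cs.signedConj).prod := by
    intro ω
    rw [wordProd, map_list_prod, List.map_map]
    congr 2
    funext i
    exact cs.lift_apply_simple _ i
  have := congrFun ((hφ ω).symm.trans ((congrArg _ h).trans (hφ ω'))) (x, 0)
  rw [prod_map_signedConj_apply, prod_map_signedConj_apply] at this
  simpa using congrArg Prod.snd this

theorem simple_mem_rightInvSeq {ω : List B} {i : B}
    (h : cs.IsRightDescent (cs.wordProd ω) i) : cs.simple i ∈ cs.rightInvSeq ω := by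
  classical
  obtain ⟨ω', hω', he⟩ := cs.exists_isReduced (cs.wordProd ω * cs.simple i)
  have hp : cs.wordProd ω = cs.wordProd (ω'.concat i) := by
    rw [wordProd_concat, ← he, simple_mul_simple_cancel_right]
  have hr : cs.IsReduced (ω'.concat i) := by
    have := cs.isRightDescent_iff.1 h
    rw [he, hω'.eq] at this
    rw [IsReduced, ← hp, ← this]; simp
  have hc : (cs.rightInvSeq (ω'.concat i)).count (cs.simple i) = 1 :=
    List.count_eq_one_of_mem hr.nodup_rightInvSeq (by rw [rightInvSeq_concat]; simp)
  have := cs.count_rightInvSeq_eq_of_wordProd_eq hp (cs.simple i)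
  rw [hc] at this
  by_contra hn
  rw [List.count_eq_zero_of_not_mem hn] at this
  simp at this

theorem simple_mem_leftInvSeq {ω : List B} {i : B}
    (h : cs.IsLeftDescent (cs.wordProd ω) i) : cs.simple i ∈ cs.leftInvSeq ω := by
  have hrev : cs.IsRightDescent (cs.wordProd ω.reverse) i := by
    rwa [wordProd_reverse, isRightDescent_inv_iff]
  simpa [rightInvSeq_reverse] using cs.simple_mem_rightInvSeq hrev

/-- The exchange condition. -/
theorem exists_eraseIdx_of_isLeftDescent {ω : List B} {i : B}
    (h : cs.IsLeftDescent (cs.wordProd ω) i) :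
    ∃ j < ω.length, cs.simple i * cs.wordProd ω = cs.wordProd (ω.eraseIdx j) := by
  obtain ⟨j, hj, he⟩ := List.getElem_of_mem (cs.simple_mem_leftInvSeq h)
  refine ⟨j, by simpa using hj, ?_⟩
  rw [← getD_leftInvSeq_mul_wordProd, List.getD_eq_getElem _ _ hj, he]

theorem finite_isLeftDescent (w : W) : {s | ∃ i, cs.IsLeftDescent w i ∧ cs.simple i = s}.Finite := by
  obtain ⟨ω, -, rfl⟩ := cs.exists_isReduced w
  refine (List.finite_toSet (cs.leftInvSeq ω)).subset ?_
  rintro _ ⟨i, hi, rfl⟩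
  exact cs.simple_mem_leftInvSeq hi

/-- If `i` is a left descent of `w`, then it is a left descent of `w * s j` for every `j`, unless
`s i * w = w * s j`. -/
theorem simple_mul_eq_mul_simple_or_length_lt {w : W} {i : B} (hi : cs.IsLeftDescent w i)
    (j : B) :
    cs.simple i * w = w * cs.simple j ∨
      cs.length (cs.simple i * (w * cs.simple j)) < cs.length (w * cs.simple j) := by
  obtain ⟨ω, hω, he⟩ := cs.exists_isReduced (w * cs.simple j)
  have hw : w = cs.wordProd (ω ++ [j]) := by simp [wordProd_append, ← he]
  rw [hw] at hi
  obtain ⟨k, hk, hk'⟩ := cs.exists_eraseIdx_of_isLeftDescent hi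
  rw [← hw] at hk'
  by_cases hlt : k < ω.length
  · right
    rw [List.eraseIdx_append_of_lt_length hlt, wordProd_append, wordProd_singleton] at hk'
    rw [← mul_assoc, hk', simple_mul_simple_cancel_right, he, hω.eq]
    refine (cs.length_wordProd_le _).trans_lt ?_
    rw [List.length_eraseIdx_of_lt hlt]; omega
  · left
    have hk0 : k = ω.length := by simp at hk; omega
    rw [hk', hk0, he, List.eraseIdx_append_of_length_le le_rfl]
    simp

theorem exists_isReduced_of_mem_closure {K : Set W} (hK : K ⊆ Set.range cs.simple) {x : W}
    (hx : x ∈ Subgroup.closure K) :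
    ∃ ω : List B, cs.IsReduced ω ∧ cs.wordProd ω = x ∧ ∀ i ∈ ω, cs.simple i ∈ K := by
  have step : ∀ s ∈ K, ∀ y, (∃ ω : List B, cs.IsReduced ω ∧ cs.wordProd ω = y ∧
      ∀ i ∈ ω, cs.simple i ∈ K) → ∃ ω : List B, cs.IsReduced ω ∧ cs.wordProd ω = s * y ∧
      ∀ i ∈ ω, cs.simple i ∈ K := by
    rintro s hs y ⟨ω, hω, rfl, hωK⟩
    obtain ⟨i, rfl⟩ := hK hs
    by_cases hd : cs.IsLeftDescent (cs.wordProd ω) i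
    · obtain ⟨j, hj, he⟩ := cs.exists_eraseIdx_of_isLeftDescent hd
      refine ⟨ω.eraseIdx j, ?_, he.symm, fun k hk => hωK k (List.mem_of_mem_eraseIdx hk)⟩
      have := cs.isLeftDescent_iff.1 hd
      rw [hω.eq, he] at this
      rw [IsReduced, List.length_eraseIdx_of_lt hj]; omega
    · refine ⟨i :: ω, ?_, wordProd_cons .., by simpa using ⟨hs, hωK⟩⟩
      rw [IsReduced, wordProd_cons, cs.not_isLeftDescent_iff.1 hd, hω.eq, List.length_cons]
  induction hx using Subgroup.closure_induction_left with
  | one => exact ⟨[], by simp [IsReduced], by simp, by simp⟩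
  | mul_left s hs y _ ih => exact step s hs y ih
  | inv_mul_cancel s hs y _ ih =>
    obtain ⟨i, rfl⟩ := hK hs
    rw [inv_simple]
    exact step _ hs y ih

theorem exists_isRightDescent_of_mem_closure {K : Set W} (hK : K ⊆ Set.range cs.simple) {x : W}
    (hx : x ∈ Subgroup.closure K) (h1 : x ≠ 1) :
    ∃ i, cs.simple i ∈ K ∧ cs.IsRightDescent x i := by
  obtain ⟨ω, hω, rfl, hωK⟩ := cs.exists_isReduced_of_mem_closure hK hx
  rcases List.eq_nil_or_concat ω with rfl | ⟨ω', i, rfl⟩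
  · simp at h1
  · refine ⟨i, hωK i (by simp), ?_⟩
    rw [IsRightDescent, hω.eq, wordProd_concat, simple_mul_simple_cancel_right]
    simpa using Nat.lt_succ_of_le (cs.length_wordProd_le ω')

theorem length_inv_mul_add_length {K : Set W} (hK : K ⊆ Set.range cs.simple) {w x : W}
    (hw : ∀ i, cs.simple i ∈ K → cs.IsLeftDescent w i) (hx : x ∈ Subgroup.closure K) :
    cs.length (x⁻¹ * w) + cs.length x = cs.length w := by
  obtain ⟨ω, hω, rfl, hωK⟩ := cs.exists_isReduced_of_mem_closure hK hx
  clear hx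
  induction ω with
  | nil => simp
  | cons i ω ih =>
    have hω' : cs.IsReduced ω := by simpa using hω.drop 1
    specialize ih hω' fun k hk => hωK k (List.mem_cons_of_mem _ hk)
    refine le_antisymm ?_ ?_
    · obtain ⟨ζ, hζ, he⟩ := cs.exists_isReduced ((cs.wordProd ω)⁻¹ * w)
      have hwp : w = cs.wordProd (ω ++ ζ) := by rw [wordProd_append, ← he]; group
      have hi := hw i (hωK i (by simp))
      rw [hwp] at hi
      obtain ⟨k, hk, hk'⟩ := cs.exists_eraseIdx_of_isLeftDescent hi
      rw [← hwp] at hk'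
      by_cases hlt : k < ω.length
      · exfalso
        rw [List.eraseIdx_append_of_lt_length hlt, hwp, wordProd_append, wordProd_append,
          ← mul_assoc, mul_left_inj, ← wordProd_cons] at hk'
        have := cs.length_wordProd_le (ω.eraseIdx k)
        rw [← hk', hω.eq, List.length_eraseIdx_of_lt hlt, List.length_cons] at this
        omega
      · rw [List.eraseIdx_append_of_length_le (not_lt.1 hlt), wordProd_append] at hk'
        have : (cs.wordProd (i :: ω))⁻¹ * w = cs.wordProd (ζ.eraseIdx (k - ω.length)) := by
          rw [wordProd_cons, mul_inv_rev, inv_simple, mul_assoc, hk']; group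
        rw [this, hω.eq]
        have hle := cs.length_wordProd_le (ζ.eraseIdx (k - ω.length))
        have hkl : k - ω.length < ζ.length := by simp at hk; omega
        rw [List.length_eraseIdx_of_lt hkl] at hle
        rw [he, hζ.eq, hω'.eq] at ih
        rw [List.length_cons]
        omega
    · have := cs.length_mul_le (cs.wordProd (i :: ω)) ((cs.wordProd (i :: ω))⁻¹ * w)
      rw [mul_inv_cancel_left] at this
      omega

/-- If all elements of `K` are left descents of `w`, then `W_K` is finite and has a longest
element. -/
theorem finite_closure_of_isLeftDescent {K : Set W} (hK : K ⊆ Set.range cs.simple) {w : W}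
    (hw : ∀ i, cs.simple i ∈ K → cs.IsLeftDescent w i) :
    (Subgroup.closure K : Set W).Finite := by
  have hfin : K.Finite := by
    refine (cs.finite_isLeftDescent w).subset fun s hs => ?_
    obtain ⟨i, rfl⟩ := hK hs
    exact ⟨i, hw i hs, rfl⟩
  have := hfin.to_subtype
  refine ((List.finite_length_le K (cs.length w)).image
    fun l => (l.map Subtype.val).prod).subset fun x hx => ?_
  obtain ⟨ω, hω, rfl, hωK⟩ := cs.exists_isReduced_of_mem_closure hK hx
  refine ⟨ω.attach.map fun i => ⟨cs.simple i.1, hωK i.1 i.2⟩, ?_, ?_⟩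
  · have := cs.length_inv_mul_add_length hK hw hx
    rw [hω.eq] at this
    simp
    omega
  · simp [wordProd, Function.comp_def]

theorem exists_longest_of_isLeftDescent {K : Set W} (hK : K ⊆ Set.range cs.simple) {w : W}
    (hw : ∀ i, cs.simple i ∈ K → cs.IsLeftDescent w i) :
    ∃ v ∈ Subgroup.closure K, ∀ u ∈ Subgroup.closure K, cs.length u ≤ cs.length v := by
  obtain ⟨v, hv, hmax⟩ := Set.exists_max_image _ cs.length
    (cs.finite_closure_of_isLeftDescent hK hw) ⟨1, one_mem _⟩
  exact ⟨v, hv, hmax⟩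

theorem eq_of_length_le_of_longest {K : Set W} (hK : K ⊆ Set.range cs.simple) {v x : W}
    (hv : v ∈ Subgroup.closure K) (hmax : ∀ u ∈ Subgroup.closure K, cs.length u ≤ cs.length v)
    (hx : x ∈ Subgroup.closure K) (hle : cs.length v ≤ cs.length x) : x = v := by
  have hd : ∀ i, cs.simple i ∈ K → cs.IsLeftDescent v i := fun i hi =>
    lt_of_le_of_ne (hmax _ (mul_mem (Subgroup.subset_closure hi) hv)) (cs.length_simple_mul_ne v i)
  have := cs.length_inv_mul_add_length hK hd hx
  have h0 : cs.length (x⁻¹ * v) = 0 := by omega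
  rw [length_eq_zero_iff] at h0
  exact inv_mul_eq_one.1 h0

/-- If all elements of `K` are left descents of `w ∈ W_J` and `w` conjugates its right descents in
`J` into `K`, then `w` is the longest element of `W_K`. -/
theorem longest_of_conj_descents {K J : Set W} (hK : K ⊆ Set.range cs.simple)
    (hJ : J ⊆ Set.range cs.simple) {w : W} (hKJ : Subgroup.closure K ≤ Subgroup.closure J)
    (hwJ : w ∈ Subgroup.closure J)
    (hw : ∀ i, cs.simple i ∈ K → cs.IsLeftDescent w i)
    (hσ : ∀ j, cs.simple j ∈ J → cs.IsRightDescent w j → ∃ s ∈ K, s * w = w * cs.simple j) :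
    w ∈ Subgroup.closure K ∧ ∀ u ∈ Subgroup.closure K, cs.length u ≤ cs.length w := by
  obtain ⟨v, hv, hmax⟩ := cs.exists_longest_of_isLeftDescent hK hw
  have hadd : ∀ x ∈ Subgroup.closure K, cs.length (x⁻¹ * w) + cs.length x = cs.length w :=
    fun x hx => cs.length_inv_mul_add_length hK hw hx
  suffices h : v⁻¹ * w = 1 by
    obtain rfl := inv_mul_eq_one.1 h
    exact ⟨hv, hmax⟩
  by_contra hne
  obtain ⟨j, hjJ, hj⟩ := cs.exists_isRightDescent_of_mem_closure hJ
    (mul_mem (inv_mem (hKJ hv)) hwJ) hne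
  have hjw : cs.IsRightDescent w j := by
    have h1 := cs.length_mul_le v (v⁻¹ * w * cs.simple j)
    have h2 := hadd v hv
    have h3 : v * (v⁻¹ * w * cs.simple j) = w * cs.simple j := by group
    rw [h3] at h1
    rw [IsRightDescent] at hj ⊢
    omega
  obtain ⟨s, hs, he⟩ := hσ j hjJ hjw
  have hsK := Subgroup.subset_closure hs
  have h4 : v⁻¹ * w * cs.simple j = (s⁻¹ * v)⁻¹ * w := by
    rw [mul_assoc, ← he]; group
  have h5 := hadd _ (mul_mem (inv_mem hsK) hv)
  have h6 := hmax _ (mul_mem (inv_mem hsK) hv)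
  have h7 := hadd v hv
  rw [IsRightDescent, h4] at hj
  omega

end CoxeterSystem

namespace QuasiFlipTwinBuilding

variable {B : Type*} {W : Type*} [Group W] {M : CoxeterMatrix B} {cs : CoxeterSystem M W}
  {Cp : Type u} {Cm : Type v} (T : QuasiFlipTwinBuilding M cs Cp Cm)

theorem δp_self (x : Cp) : T.δp x x = 1 := (T.p_eq_one_iff x x).2 rfl

theorem δp_symm_simple {x y : Cp} {s : W} (hs : s ∈ Set.range cs.simple) (h : T.δp x y = s) :
    T.δp y x = s := by
  obtain ⟨i, rfl⟩ := hs
  rcases T.p_two y x y _ ⟨i, rfl⟩ h with h1 | h1 <;> rw [δp_self] at h1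
  · obtain rfl := (T.p_eq_one_iff y x).1 h1.symm
    rw [← h, δp_self]
  · rw [eq_comm, mul_eq_one_iff_eq_inv, CoxeterSystem.inv_simple] at h1
    exact h1

theorem δst_eq_or {x : Cp} {y z : Cm} {s : W} (hs : s ∈ Set.range cs.simple) (h : T.δm y z = s) :
    T.δst x z = T.δst x y ∨ T.δst x z = T.δst x y * s := by
  obtain ⟨i, rfl⟩ := hs
  rcases cs.length_mul_simple (T.δst x y) i with hl | hl
  · obtain ⟨y', hy, hy'⟩ := T.tw3p x y _ ⟨i, rfl⟩
    have hsymm := T.swap.δp_symm_simple ⟨i, rfl⟩ hy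
    rcases T.m_two y' y z _ ⟨i, rfl⟩ h with h1 | h1 <;>
      rw [show T.δm y' y = cs.simple i from hsymm] at h1
    · left
      rw [T.tw2p x y' z _ ⟨i, rfl⟩ h1 (by rw [hy']; simpa using hl.symm), hy']
      simp
    · right
      rw [cs.simple_mul_simple_self, T.m_eq_one_iff] at h1
      rw [← h1, hy']
  · exact Or.inr (T.tw2p x y z _ ⟨i, rfl⟩ h hl)

theorem δp_inv_mul_mem {K : Set W} (hK : K ⊆ Set.range cs.simple) (x : Cp) {y z : Cp}
    (h : T.δp y z ∈ Subgroup.closure K) :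
    (T.δp x y)⁻¹ * T.δp x z ∈ Subgroup.closure K := by
  suffices key : ∀ v ∈ Subgroup.closure K, ∀ z, T.δp y z = v →
      (T.δp x y)⁻¹ * T.δp x z ∈ Subgroup.closure K from key _ h z rfl
  clear h z
  have step : ∀ s ∈ K, ∀ v, (∀ z, T.δp y z = v →
      (T.δp x y)⁻¹ * T.δp x z ∈ Subgroup.closure K) → ∀ z, T.δp y z = v * s →
      (T.δp x y)⁻¹ * T.δp x z ∈ Subgroup.closure K := by
    intro s hs v ih z hz
    obtain ⟨z', hz', hyz'⟩ := T.p_three y z s (hK hs)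
    have hss : s * s = 1 := by obtain ⟨i, rfl⟩ := hK hs; simp
    rw [hz, mul_assoc, hss, mul_one] at hyz'
    rcases T.p_two x z' z s (hK hs) (T.δp_symm_simple (hK hs) hz') with h | h <;> rw [h]
    · exact ih z' hyz'
    · rw [← mul_assoc]
      exact mul_mem (ih z' hyz') (Subgroup.subset_closure hs)
  intro v hv
  induction hv using Subgroup.closure_induction_right with
  | one =>
    intro z hz
    rw [(T.p_eq_one_iff y z).1 hz, inv_mul_cancel]
    exact one_mem _
  | mul_right v _ s hs ih => exact step s hs v ih
  | mul_inv_cancel v _ s hs ih =>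
    have : s⁻¹ = s := by obtain ⟨i, rfl⟩ := hK hs; simp
    rw [this]
    exact step s hs v ih

theorem δp_inv_mem {K : Set W} (hK : K ⊆ Set.range cs.simple) {x y : Cp}
    (h : T.δp x y ∈ Subgroup.closure K) : T.δp y x ∈ Subgroup.closure K := by
  simpa [δp_self] using T.δp_inv_mul_mem hK y h

theorem residue_eq {K : Set W} (hK : K ⊆ Set.range cs.simple) {x y : Cp}
    (h : y ∈ T.residue K x) : T.residue K x = T.residue K y := by
  ext z
  have h' : T.δp y x ∈ Subgroup.closure K := T.δp_inv_mem hK h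
  constructor
  · intro hz
    exact (Subgroup.mul_mem_cancel_left _ (inv_mem h')).1 (T.δp_inv_mul_mem hK y hz)
  · intro hz
    exact (Subgroup.mul_mem_cancel_left _ (inv_mem h)).1 (T.δp_inv_mul_mem hK x hz)

theorem δst_inv_mul_mem {K : Set W} (hK : K ⊆ Set.range cs.simple) (x : Cp) {y z : Cm}
    (h : T.δm y z ∈ Subgroup.closure K) :
    (T.δst x y)⁻¹ * T.δst x z ∈ Subgroup.closure K := by
  suffices key : ∀ v ∈ Subgroup.closure K, ∀ z, T.δm y z = v →
      (T.δst x y)⁻¹ * T.δst x z ∈ Subgroup.closure K from key _ h z rfl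
  clear h z
  have step : ∀ s ∈ K, ∀ v, (∀ z, T.δm y z = v →
      (T.δst x y)⁻¹ * T.δst x z ∈ Subgroup.closure K) → ∀ z, T.δm y z = v * s →
      (T.δst x y)⁻¹ * T.δst x z ∈ Subgroup.closure K := by
    intro s hs v ih z hz
    obtain ⟨z', hz', hyz'⟩ := T.m_three y z s (hK hs)
    have hss : s * s = 1 := by obtain ⟨i, rfl⟩ := hK hs; simp
    rw [hz, mul_assoc, hss, mul_one] at hyz'
    rcases T.δst_eq_or (x := x) (hK hs) (T.swap.δp_symm_simple (hK hs) hz') with h | h <;> rw [h]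
    · exact ih z' hyz'
    · rw [← mul_assoc]
      exact mul_mem (ih z' hyz') (Subgroup.subset_closure hs)
  intro v hv
  induction hv using Subgroup.closure_induction_right with
  | one =>
    intro z hz
    rw [(T.m_eq_one_iff y z).1 hz, inv_mul_cancel]
    exact one_mem _
  | mul_right v _ s hs ih => exact step s hs v ih
  | mul_inv_cancel v _ s hs ih =>
    have : s⁻¹ = s := by obtain ⟨i, rfl⟩ := hK hs; simp
    rw [this]
    exact step s hs v ih

theorem exists_δp_eq {K : Set W} (hK : K ⊆ Set.range cs.simple) (x : Cp) {v : W}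
    (hv : v ∈ Subgroup.closure K) : ∃ z, T.δp x z = v := by
  have step : ∀ s ∈ K, ∀ v, (∃ z, T.δp x z = v) → ∃ z, T.δp x z = v * s := by
    rintro s hs _ ⟨z, rfl⟩
    obtain ⟨z', -, hz'⟩ := T.p_three x z s (hK hs)
    exact ⟨z', hz'⟩
  induction hv using Subgroup.closure_induction_right with
  | one => exact ⟨x, T.δp_self x⟩
  | mul_right v _ s hs ih => exact step s hs v ih
  | mul_inv_cancel v _ s hs ih =>
    have : s⁻¹ = s := by obtain ⟨i, rfl⟩ := hK hs; simp
    rw [this]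
    exact step s hs v ih

theorem exists_δst_eq_mul {K : Set W} (hK : K ⊆ Set.range cs.simple) (x : Cp) (y : Cm) {v : W}
    (hv : v ∈ Subgroup.closure K) :
    ∃ z, T.δm y z ∈ Subgroup.closure K ∧ T.δst x z = T.δst x y * v := by
  have step : ∀ s ∈ K, ∀ v,
      (∃ z, T.δm y z ∈ Subgroup.closure K ∧ T.δst x z = T.δst x y * v) →
      ∃ z, T.δm y z ∈ Subgroup.closure K ∧ T.δst x z = T.δst x y * (v * s) := by
    rintro s hs v ⟨z, hz, hv⟩
    obtain ⟨z', hzz', hz'⟩ := T.tw3p x z s (hK hs)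
    refine ⟨z', ?_, by rw [hz', hv, mul_assoc]⟩
    have hmem : T.δm z z' ∈ Subgroup.closure K := by
      rw [hzz']; exact Subgroup.subset_closure hs
    exact (Subgroup.mul_mem_cancel_left _ (inv_mem hz)).1 (T.swap.δp_inv_mul_mem hK y hmem)
  induction hv using Subgroup.closure_induction_right with
  | one => exact ⟨y, by rw [(T.m_eq_one_iff y y).2 rfl]; exact one_mem _, by simp⟩
  | mul_right v _ s hs ih => exact step s hs v ih
  | mul_inv_cancel v _ s hs ih =>
    have : s⁻¹ = s := by obtain ⟨i, rfl⟩ := hK hs; simp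
    rw [this]
    exact step s hs v ih

theorem length_π_le (w : W) : cs.length (T.π w) ≤ cs.length w := by
  have key : ∀ ω : List B, cs.length (T.π (cs.wordProd ω)) ≤ ω.length := by
    intro ω
    induction ω with
    | nil => simp
    | cons i ω ih =>
      obtain ⟨j, hj⟩ : T.π (cs.simple i) ∈ Set.range cs.simple := by
        rw [← T.πS]; exact ⟨_, ⟨i, rfl⟩, rfl⟩
      rw [CoxeterSystem.wordProd_cons, map_mul, ← hj, List.length_cons]
      have := cs.length_mul_le (cs.simple j) (T.π (cs.wordProd ω))
      rw [cs.length_simple] at this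
      omega
  obtain ⟨ω, hω, rfl⟩ := cs.exists_isReduced w
  rw [hω.eq]
  exact key ω

theorem length_π (w : W) : cs.length (T.π w) = cs.length w :=
  le_antisymm (T.length_π_le w) (by simpa [T.ππ] using T.length_π_le (T.π w))

theorem π_image_subset {K : Set W} (hK : K ⊆ Set.range cs.simple) :
    T.π '' K ⊆ Set.range cs.simple := by
  rw [← T.πS]
  exact Set.image_mono hK

theorem π_mem_closure_image {K : Set W} {x : W} (hx : x ∈ Subgroup.closure K) :
    T.π x ∈ Subgroup.closure (T.π '' K) := by
  have := Subgroup.mem_map_of_mem T.π.toMonoidHom hx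
  rwa [MonoidHom.map_closure] at this

/-- If `π` maps `K` into `W_K`, then it preserves `W_K`. -/
theorem π_mem_closure {K : Set W} (h : ∀ s ∈ K, T.π s ∈ Subgroup.closure K) {x : W}
    (hx : x ∈ Subgroup.closure K) : T.π x ∈ Subgroup.closure K :=
  (Subgroup.closure_le _).2 (by rintro _ ⟨s, hs, rfl⟩; exact h s hs) (T.π_mem_closure_image hx)

theorem inv_δθ (c : Cp) : (T.δθ c)⁻¹ = T.π (T.δθ c) := by
  rw [δθ, ← T.tw1, ← T.flip_st, T.θmθp]

/-- If `s * w ≠ w * π s` for a left descent `s` of the `θ`-codistance `w` of `c`, then the `s`-panel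
of `c` contains a chamber of smaller numerical `θ`-codistance. -/
theorem exists_ℓθ_lt {c : Cp} {i : B} (hi : cs.IsLeftDescent (T.δθ c) i)
    (hne : cs.simple i * T.δθ c ≠ T.δθ c * T.π (cs.simple i)) :
    ∃ d, T.δp c d = cs.simple i ∧ T.ℓθ d < T.ℓθ c := by
  obtain ⟨j, hj⟩ : T.π (cs.simple i) ∈ Set.range cs.simple := by
    rw [← T.πS]; exact ⟨_, ⟨i, rfl⟩, rfl⟩
  obtain ⟨d, hd, -⟩ := T.p_three c c _ ⟨i, rfl⟩
  have hr : cs.IsRightDescent (T.δθ c) j := by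
    rw [← CoxeterSystem.isLeftDescent_inv_iff, T.inv_δθ, CoxeterSystem.IsLeftDescent, hj, ← map_mul,
      T.length_π, T.length_π]
    exact hi
  rw [← hj] at hne
  have hlt := (cs.simple_mul_eq_mul_simple_or_length_lt hi j).resolve_left hne
  have h1 : T.δst c (T.θp d) = T.δθ c * cs.simple j :=
    T.tw2p c (T.θp c) (T.θp d) _ ⟨j, rfl⟩ (by rw [T.flip_p, hd, hj])
      ((cs.isRightDescent_iff).1 hr)
  have h2 : T.δts (T.θp d) c = (T.δθ c * cs.simple j)⁻¹ := by rw [T.tw1, h1]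
  have h3 : (T.δθ c * cs.simple j)⁻¹ * cs.simple i =
      (cs.simple i * (T.δθ c * cs.simple j))⁻¹ := by
    rw [mul_inv_rev (cs.simple i), cs.inv_simple]
  have h4 : T.δts (T.θp d) d = (T.δθ c * cs.simple j)⁻¹ * cs.simple i := by
    rw [← h2]
    refine T.tw2m _ c d _ ⟨i, rfl⟩ hd ?_
    rw [h2, h3, cs.length_inv, cs.length_inv]
    exact cs.isLeftDescent_iff.1 hlt
  refine ⟨d, hd, ?_⟩
  have h5 : T.δθ d = cs.simple i * (T.δθ c * cs.simple j) := by
    rw [T.tw1, h3, inv_inj] at h4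
    exact h4
  rw [ℓθ, ℓθ, h5]
  exact hlt.trans hr

/-- The type of a Phan residue generates a `π`-stable subgroup. -/
theorem IsPhan.π_mem {I : Set W} (hI : I ⊆ Set.range cs.simple) {R : Set Cp} (hR : T.IsPhan I R)
    {x : W} (hx : x ∈ Subgroup.closure I) : T.π x ∈ Subgroup.closure I := by
  obtain ⟨⟨c, rfl⟩, h1, h2⟩ := hR
  have hπ : ∀ s ∈ I, s ∈ Subgroup.closure (T.π '' I) := by
    intro s hs
    have hc : c ∈ T.residue I c := by simp [residue, δp_self]
    obtain ⟨r, hr, ho⟩ := h1 c hc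
    obtain ⟨d, hcd, hd⟩ := T.tw3m (T.θp r) c s (hI hs)
    have hdR : d ∈ T.residue I c := by
      rw [residue, Set.mem_ofPred_eq, hcd]; exact Subgroup.subset_closure hs
    obtain ⟨r', hr', ho'⟩ := h1 d hdR
    rw [T.tw1, T.tw1, show T.δst c (T.θp r) = 1 from ho, inv_one, one_mul, inv_eq_iff_eq_inv] at hd
    rw [T.residue_eq hI hr] at hr'
    have hm := T.π_mem_closure_image hr'
    rw [← T.flip_p] at hm
    have := T.δst_inv_mul_mem (T.π_image_subset hI) d hm
    rwa [show T.δst d (T.θp r') = 1 from ho', hd, inv_inv, mul_one] at this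
  have := T.π_mem_closure_image ((Subgroup.closure_le _).2 hπ hx)
  rwa [← Set.image_comp, show T.π ∘ T.π = id from funext T.ππ, Set.image_id] at this

/-- If `π` preserves `W_K` and `δ^θ(c) ∈ W_K`, then every chamber of the `K`-residue of `c` is
opposite the image of another one. -/
theorem isPhan_residue {K : Set W} (hK : K ⊆ Set.range cs.simple)
    (hπ : ∀ x ∈ Subgroup.closure K, T.π x ∈ Subgroup.closure K) {c : Cp}
    (hc : T.δθ c ∈ Subgroup.closure K) : T.IsPhan K (T.residue K c) := by
  refine ⟨⟨c, rfl⟩, fun r hr => ?_, fun r hr => ?_⟩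
  · have h1 : T.δst r (T.θp c) ∈ Subgroup.closure K := by
      have := T.swap.δst_inv_mul_mem hK (T.θp c) hr
      change (T.δts (T.θp c) c)⁻¹ * T.δts (T.θp c) r ∈ _ at this
      rw [T.tw1, T.tw1, inv_inv] at this
      exact inv_mem_iff.1 ((Subgroup.mul_mem_cancel_left _ hc).1 this)
    obtain ⟨z, hz, hz'⟩ := T.exists_δst_eq_mul hK r (T.θp c) (inv_mem h1)
    refine ⟨T.θm z, ?_, ?_⟩
    · have := hπ _ hz
      rwa [← T.flip_m, T.θmθp] at this
    · rw [Opp, T.θpθm, hz', mul_inv_cancel]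
  · have hr' : T.δm (T.θp c) (T.θp r) ∈ Subgroup.closure K := by
      rw [T.flip_p]; exact hπ _ hr
    have h1 : T.δts (T.θp r) c ∈ Subgroup.closure K := by
      rw [T.tw1]
      exact inv_mem ((Subgroup.mul_mem_cancel_left _ (inv_mem hc)).1 (T.δst_inv_mul_mem hK c hr'))
    obtain ⟨z, hz, hz'⟩ := T.swap.exists_δst_eq_mul hK (T.θp r) c (inv_mem h1)
    refine ⟨z, hz, ?_⟩
    have h2 : T.δts (T.θp r) z = 1 := hz'.trans (mul_inv_cancel _)
    rwa [T.tw1, inv_eq_one] at h2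

theorem IsPhan.δθ_mem {I : Set W} (hI : I ⊆ Set.range cs.simple) {R : Set Cp} (hR : T.IsPhan I R)
    {c : Cp} (hc : c ∈ R) : T.δθ c ∈ Subgroup.closure I := by
  have hπ : ∀ x ∈ Subgroup.closure I, T.π x ∈ Subgroup.closure I := fun x => hR.π_mem T hI
  obtain ⟨⟨c₀, rfl⟩, h1, -⟩ := hR
  obtain ⟨r, hr, ho⟩ := h1 c hc
  rw [T.residue_eq hI hr] at hc
  have := T.δst_inv_mul_mem (y := T.θp r) hI c (by rw [T.flip_p]; exact hπ _ hc)
  rwa [show T.δst c (T.θp r) = 1 from ho, inv_one, one_mul] at this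

end QuasiFlipTwinBuilding

open QuasiFlipTwinBuilding in
/-- If `R` is a minimal Phan residue of type `I`, then `I` is spherical (`W_I` is finite)
and the `θ`-codistance is constant on `R` with value the longest element `w_I` of
`(W_I, I)`. -/
theorem isMinPhan_spherical_and_const
    {B : Type*} {W : Type*} [Group W] {M : CoxeterMatrix B} {cs : CoxeterSystem M W}
    {Cp : Type u} {Cm : Type v} (T : QuasiFlipTwinBuilding M cs Cp Cm)
    (I : Set W) (hI : I ⊆ Set.range cs.simple) (R : Set Cp) (hR : T.IsMinPhan I R) :
    (Subgroup.closure I : Set W).Finite ∧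
    ∃ wI ∈ Subgroup.closure I,
      (∀ u ∈ Subgroup.closure I, cs.length u ≤ cs.length wI) ∧
      ∀ c ∈ R, T.δθ c = wI := by
  obtain ⟨hP, hmin⟩ := hR
  have hRc : ∀ c ∈ R, R = T.residue I c := by
    obtain ⟨⟨c₀, rfl⟩, -⟩ := hP
    exact fun c hc => T.residue_eq hI hc
  have hne : R.Nonempty := by
    obtain ⟨⟨c₀, rfl⟩, -⟩ := hP
    exact ⟨c₀, by simp [residue, δp_self]⟩
  have hπI : ∀ x ∈ Subgroup.closure I, T.π x ∈ Subgroup.closure I := fun x => hP.π_mem T hI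
  obtain ⟨c, hc, hcmin⟩ : ∃ c ∈ R, ∀ d ∈ R, T.ℓθ c ≤ T.ℓθ d := by
    obtain ⟨c, hc⟩ := exists_minimalFor_of_wellFoundedLT (· ∈ R) T.ℓθ hne
    exact ⟨c, hc.1, fun d hd => (le_total (T.ℓθ d) (T.ℓθ c)).elim (hc.2 hd) id⟩
  set w := T.δθ c with hw
  have hwI : w ∈ Subgroup.closure I := hP.δθ_mem T hI hc
  have hcomm : ∀ i, cs.simple i ∈ I → cs.IsLeftDescent w i →
      cs.simple i * w = w * T.π (cs.simple i) := by
    intro i hi hd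
    by_contra hne
    obtain ⟨d, hcd, hlt⟩ := T.exists_ℓθ_lt hd hne
    refine hlt.not_ge (hcmin d ?_)
    rw [hRc c hc, residue, Set.mem_ofPred_eq, hcd]
    exact Subgroup.subset_closure hi
  set K : Set W := {s ∈ I | ∃ i, cs.IsLeftDescent w i ∧ cs.simple i = s} with hKdef
  have hKI : K ⊆ I := fun s hs => hs.1
  have hK : K ⊆ Set.range cs.simple := hKI.trans hI
  have hKd : ∀ i, cs.simple i ∈ K → cs.IsLeftDescent w i := by
    rintro i ⟨-, j, hj, he⟩
    rwa [CoxeterSystem.IsLeftDescent, ← he]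
  have hII : Subgroup.closure I ≤ Subgroup.closure (T.π '' I) := fun x hx => by
    simpa [T.ππ] using T.π_mem_closure_image (hπI x hx)
  obtain ⟨hwK, hmax⟩ := cs.longest_of_conj_descents (J := T.π '' I) hK (T.π_image_subset hI)
    ((Subgroup.closure_mono hKI).trans hII) (hII hwI) hKd (by
      rintro j ⟨s, hs, hsj⟩ hj
      obtain ⟨i, rfl⟩ := hI hs
      have hi : cs.IsLeftDescent w i := by
        rw [← CoxeterSystem.isRightDescent_inv_iff, hw, T.inv_δθ, CoxeterSystem.IsRightDescent,
          ← T.length_π, map_mul, T.ππ, hsj, T.length_π]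
        exact hj
      exact ⟨_, ⟨hs, i, hi, rfl⟩, hsj ▸ hcomm i hs hi⟩)
  have hπK : ∀ x ∈ Subgroup.closure K, T.π x ∈ Subgroup.closure K := by
    refine fun x => T.π_mem_closure fun s hs => ?_
    obtain ⟨i, rfl⟩ := hK hs
    rw [← (inv_mul_eq_iff_eq_mul.2 (hcomm i hs.1 (hKd i hs)))]
    exact mul_mem (inv_mem hwK) (mul_mem (Subgroup.subset_closure hs) hwK)
  have hRK : T.residue K c = R := by
    refine hmin K _ hK (T.isPhan_residue hK hπK hwK) ?_
    rw [hRc c hc]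
    exact fun d hd => Subgroup.closure_mono hKI hd
  have hIK : Subgroup.closure I = Subgroup.closure K := by
    refine le_antisymm (fun x hx => ?_) (Subgroup.closure_mono hKI)
    obtain ⟨z, rfl⟩ := T.exists_δp_eq hI c hx
    have hz : z ∈ T.residue I c := hx
    rwa [← hRc c hc, ← hRK] at hz
  have hmem : ∀ d ∈ R, T.δθ d ∈ Subgroup.closure K := fun d hd => hIK ▸ hP.δθ_mem T hI hd
  rw [hIK]
  exact ⟨cs.finite_closure_of_isLeftDescent hK hKd, w, hwK, hmax, fun d hd =>
    cs.eq_of_length_le_of_longest hK hwK hmax (hmem d hd) (hcmin d hd)⟩
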